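/- In Version B, a position with exactly five piles is a P-position if and only if its multiset of pile sizes has one of the following forms: (1) {1, 1, a, b, c} with a, b, c even; (2) {1, 1, a, b, c} with a even and b, c odd; (3) {1, 2, a, b, c} with a, b even and c odd with c ≥ 3; (4) {1, a, b, c, d} with a, b even, a, b ≥ 4, and c, d odd, c, d ≥ 5; (5) all five pile sizes even; (6) exactly one pile size even and the other four odd, each odd pile of size at least 3; (7) exactly three pile sizes even and two odd, each odd pile of size at least 3 — except for the positions of the form {2, a, b, c, d} with a, b even, a, b ≥ 4, and c, d odd, c, d ≥ 5, which are N-positions. -/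

import Mathlib

/-- Remove one token from a pile of size `p` in `G`: delete one copy of `p` and,
if `p ≠ 1`, add back a pile of size `p - 1`. -/
def takeOne (G : Multiset ℕ) (p : ℕ) : Multiset ℕ :=
  G.erase p + (if p = 1 then (0 : Multiset ℕ) else {p - 1})

/-- Legal moves of Version B: remove one token from one chosen pile, or remove
one token from every pile simultaneously (piles reaching size 0 are deleted). -/
inductive MoveB : Multiset ℕ → Multiset ℕ → Prop
  | one {G : Multiset ℕ} {p : ℕ} (hp : p ∈ G) (h1 : 1 ≤ p) : MoveB G (takeOne G p)
  | all {G : Multiset ℕ} (hG : G ≠ 0) : MoveB G ((G.map (· - 1)).filter (· ≠ 0))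

mutual
  /-- P-positions of Version B under normal play: every move leads to an N-position
  (in particular the empty position is a P-position).  Since every move strictly
  decreases the total number of tokens, this inductive definition agrees with the
  usual recursive definition of outcome classes. -/
  inductive PPosB : Multiset ℕ → Prop
    | mk : ∀ {G : Multiset ℕ}, (∀ H, MoveB G H → NPosB H) → PPosB G
  /-- N-positions of Version B under normal play: some move leads to a P-position. -/
  inductive NPosB : Multiset ℕ → Prop
    | mk : ∀ {G H : Multiset ℕ}, MoveB G H → PPosB H → NPosB G
end

/-- The data of a position that decides its outcome when there are at most five piles. -/
structure Profile where
  /-- the number of piles -/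
  piles : ℕ
  /-- the number of piles of odd size -/
  odds : ℕ
  /-- the number of piles of size one -/
  ones : ℕ
  /-- the number of piles of size two -/
  twos : ℕ
  /-- the number of piles of size three -/
  threes : ℕ

/-- The profile of a position. -/
def profile (G : Multiset ℕ) : Profile :=
  ⟨G.card, G.countP Odd, G.count 1, G.count 2, G.count 3⟩

/-- The profiles of the P-positions with at most five piles. -/
def Profile.IsP (t : Profile) : Prop :=
  (t.piles ≤ 3 ∧ Even t.odds ∧ (t.piles = 2 → t.odds = 0)) ∨
  (t.piles = 4 ∧ (t.ones = 0 ∧ (t.odds = 0 ∨ t.odds = 3) ∨ t.ones = 2 ∧ t.odds = 2)) ∨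
  (t.piles = 5 ∧
    (2 ≤ t.ones ∧ (t.odds = 2 ∨ t.odds = 4) ∨
      t.ones = 1 ∧ (1 ≤ t.twos ∧ t.odds = 2 ∨ t.twos = 0 ∧ t.odds = 3 ∧ t.threes = 0) ∨
      t.ones = 0 ∧ (t.odds = 0 ∨ t.odds = 4 ∨ t.odds = 2 ∧ ¬ (t.twos = 1 ∧ t.threes = 0))))

instance : DecidablePred Profile.IsP := fun t => by unfold Profile.IsP; infer_instance

/-- The profiles reached by the moves from a position of profile `t` with `f` piles of size four. -/
def Profile.options (t : Profile) (f : ℕ) : List Profile :=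
  (if 1 ≤ t.ones then [⟨t.piles - 1, t.odds - 1, t.ones - 1, t.twos, t.threes⟩] else []) ++
  (if 1 ≤ t.twos then [⟨t.piles, t.odds + 1, t.ones + 1, t.twos - 1, t.threes⟩] else []) ++
  (if 1 ≤ t.threes then [⟨t.piles, t.odds - 1, t.ones, t.twos + 1, t.threes - 1⟩] else []) ++
  (if 1 ≤ f then [{ t with odds := t.odds + 1, threes := t.threes + 1 }] else []) ++
  (if t.ones + t.threes < t.odds then [{ t with odds := t.odds - 1 }] else []) ++
  (if t.twos + f + t.odds < t.piles then [{ t with odds := t.odds + 1 }] else []) ++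
  (if 1 ≤ t.piles then [⟨t.piles - t.ones, t.piles - t.odds, t.twos, t.threes, f⟩] else [])

theorem Profile.mem_options {t u : Profile} {f : ℕ} :
    u ∈ t.options f ↔
      (1 ≤ t.ones ∧ u = ⟨t.piles - 1, t.odds - 1, t.ones - 1, t.twos, t.threes⟩) ∨
      (1 ≤ t.twos ∧ u = ⟨t.piles, t.odds + 1, t.ones + 1, t.twos - 1, t.threes⟩) ∨
      (1 ≤ t.threes ∧ u = ⟨t.piles, t.odds - 1, t.ones, t.twos + 1, t.threes - 1⟩) ∨
      (1 ≤ f ∧ u = { t with odds := t.odds + 1, threes := t.threes + 1 }) ∨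
      (t.ones + t.threes < t.odds ∧ u = { t with odds := t.odds - 1 }) ∨
      (t.twos + f + t.odds < t.piles ∧ u = { t with odds := t.odds + 1 }) ∨
      (1 ≤ t.piles ∧ u = ⟨t.piles - t.ones, t.piles - t.odds, t.twos, t.threes, f⟩) := by
  simp only [options, List.mem_append, List.mem_ite_nil_right, List.mem_singleton, or_assoc]

set_option synthInstance.maxSize 1000 in
theorem Profile.isP_iff_bounded : ∀ n < 6, ∀ d < n + 1, ∀ a < d + 1, ∀ c < d - a + 1,
    ∀ b < n - d + 1, ∀ f < n - d - b + 1,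
      ((Profile.mk n d a b c).IsP ↔ ∀ t ∈ (Profile.mk n d a b c).options f, ¬ t.IsP) := by
  set_option maxRecDepth 100000 in decide

theorem Profile.isP_iff {t : Profile} {f : ℕ} (hn : t.piles ≤ 5)
    (hodd : t.ones + t.threes ≤ t.odds) (heven : t.twos + f + t.odds ≤ t.piles) :
    t.IsP ↔ ∀ u ∈ t.options f, ¬ u.IsP := by
  obtain ⟨n, d, a, b, c⟩ := t
  dsimp only at hn hodd heven
  exact isP_iff_bounded n (by omega) d (by omega) a (by omega) c (by omega) b (by omega) f
    (by omega)

theorem PPosB.not_nPosB {G : Multiset ℕ} (h : PPosB G) : ¬ NPosB G := by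
  refine PPosB.rec (motive_1 := fun G _ => ¬ NPosB G) (motive_2 := fun G _ => ¬ PPosB G)
    ?_ ?_ h
  · rintro G _ ih ⟨m, hH⟩
    exact ih _ m hH
  · rintro G H m _ ih ⟨h⟩
    exact ih (h H m)

theorem countP_odd_eq (G : Multiset ℕ) :
    G.countP Odd = G.count 1 + G.count 3 + G.countP (fun p => Odd p ∧ 5 ≤ p) := by
  induction G using Multiset.induction with
  | empty => rfl
  | cons p G ih =>
    simp only [Multiset.countP_cons, Multiset.count_cons, ih]
    grind

theorem card_eq_of_zero_notMem {G : Multiset ℕ} (hG : 0 ∉ G) :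
    G.card = G.countP Odd + G.count 2 + G.count 4 + G.countP (fun p => Even p ∧ 6 ≤ p) := by
  induction G using Multiset.induction with
  | empty => rfl
  | cons p G ih =>
    rw [Multiset.mem_cons, not_or] at hG
    simp only [Multiset.countP_cons, Multiset.count_cons, Multiset.card_cons, ih hG.2]
    grind

theorem profile_map_pred {G : Multiset ℕ} (hG : 0 ∉ G) :
    profile ((G.map (· - 1)).filter (· ≠ 0)) =
      ⟨G.card - G.count 1, G.card - G.countP Odd, G.count 2, G.count 3, G.count 4⟩ := by
  induction G using Multiset.induction with
  | empty => rfl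
  | cons p G ih =>
    rw [Multiset.mem_cons, not_or] at hG
    have h0 := hG.1
    have h1 := Multiset.count_le_card 1 G
    have h2 := Multiset.countP_le_card Odd G
    have ih := ih hG.2
    simp only [profile, Profile.mk.injEq] at ih ⊢
    simp only [Multiset.map_cons, Multiset.filter_cons, Multiset.countP_cons,
      Multiset.count_cons, Multiset.card_cons, Multiset.card_add, Multiset.countP_add,
      Multiset.count_add] at ih ⊢
    by_cases hp : p = 1
    · subst hp
      simp only [tsub_self, ne_eq, not_true_eq_false, if_false] at ih ⊢
      simp only [Multiset.card_zero, Multiset.countP_zero, Multiset.count_zero, odd_one, if_true]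
      grind
    · rw [if_pos (by omega)]
      simp only [← Multiset.cons_zero, Multiset.countP_cons,
        Multiset.count_cons, Multiset.countP_zero, Multiset.count_zero, Multiset.card_cons,
        Multiset.card_zero]
      grind

theorem profile_takeOne {G : Multiset ℕ} {p : ℕ} (h0 : p ≠ 0) (hp : p ∈ G) :
    profile (takeOne G p) =
      { piles := if p = 1 then G.card - 1 else G.card
        odds := if Odd p then G.countP Odd - 1 else G.countP Odd + 1
        ones := if p = 1 then G.count 1 - 1 else if p = 2 then G.count 1 + 1 else G.count 1
        twos := if p = 2 then G.count 2 - 1 else if p = 3 then G.count 2 + 1 else G.count 2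
        threes := if p = 3 then G.count 3 - 1 else if p = 4 then G.count 3 + 1 else G.count 3 } := by
  obtain ⟨G, rfl⟩ := Multiset.exists_cons_of_mem hp
  by_cases h1 : p = 1
  · simp [profile, takeOne, h1]
  · simp only [profile, takeOne, h1, Multiset.erase_cons_head, if_false, Multiset.card_add,
      Multiset.countP_add, Multiset.count_add, Multiset.countP_cons, Multiset.count_cons,
      Multiset.card_cons, ← Multiset.cons_zero, Multiset.card_zero, Multiset.countP_zero,
      Multiset.count_zero, Profile.mk.injEq]
    grind

theorem MoveB.profile_mem_options {G H : Multiset ℕ} (hG : 0 ∉ G) (h : MoveB G H) :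
    profile H ∈ (profile G).options (G.count 4) := by
  rw [Profile.mem_options]
  cases h with
  | @one p hp h1 =>
    rw [profile_takeOne (by omega) hp]
    have hodd := countP_odd_eq G
    have heven := card_eq_of_zero_notMem hG
    have hpos : 1 ≤ G.count p := Multiset.count_pos.2 hp
    have large {q : ℕ → Prop} [DecidablePred q] (h : q p) : 0 < G.countP q :=
      Multiset.countP_pos_of_mem hp h
    rcases (by grind : p = 1 ∨ p = 2 ∨ p = 3 ∨ p = 4 ∨ (Odd p ∧ 5 ≤ p) ∨ (Even p ∧ 6 ≤ p)) with
      rfl | rfl | rfl | rfl | h | h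
    · left; simpa [profile] using hpos
    · right; left; simpa [profile] using hpos
    · right; right; left; simpa [profile, show Odd 3 by decide] using hpos
    · right; right; right; left; simpa [profile, show ¬ Odd 4 by decide] using hpos
    · right; right; right; right; left
      have := large (q := fun p => Odd p ∧ 5 ≤ p) h
      simp only [profile, Profile.mk.injEq]
      grind
    · right; right; right; right; right; left
      have := large (q := fun p => Even p ∧ 6 ≤ p) h
      simp only [profile, Profile.mk.injEq]
      grind
  | all hne =>
    rw [profile_map_pred hG]
    simp only [profile, Nat.one_le_iff_ne_zero, ne_eq, Multiset.card_eq_zero, hne, not_false_eq_true,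
      true_and, or_true]

theorem exists_moveB_of_mem_options {G : Multiset ℕ} (hG : 0 ∉ G) {t : Profile}
    (ht : t ∈ (profile G).options (G.count 4)) : ∃ H, MoveB G H ∧ profile H = t := by
  have hodd := countP_odd_eq G
  have heven := card_eq_of_zero_notMem hG
  have take {p : ℕ} (hp : p ∈ G) (h : profile (takeOne G p) = t) :
      ∃ H, MoveB G H ∧ profile H = t :=
    ⟨_, .one hp (Nat.pos_of_ne_zero fun h0 => hG (h0 ▸ hp)), h⟩
  rw [Profile.mem_options] at ht
  dsimp only [profile] at ht
  rcases ht with ⟨h, rfl⟩ | ⟨h, rfl⟩ | ⟨h, rfl⟩ | ⟨h, rfl⟩ | ⟨h, rfl⟩ | ⟨h, rfl⟩ | ⟨h, rfl⟩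
  · have hp := Multiset.count_pos.1 h
    exact take hp (by simp [profile_takeOne, hp])
  · have hp := Multiset.count_pos.1 h
    exact take hp (by simp [profile_takeOne, hp])
  · have hp := Multiset.count_pos.1 h
    exact take hp (by simp [profile_takeOne, hp, show Odd 3 by decide])
  · have hp := Multiset.count_pos.1 h
    exact take hp (by simp [profile_takeOne, hp, show ¬ Odd 4 by decide])
  · obtain ⟨p, hp, hpo, hp5⟩ :=
      Multiset.countP_pos.1 (show 0 < G.countP (fun p => Odd p ∧ 5 ≤ p) by omega)
    refine take hp ?_
    rw [profile_takeOne (by omega) hp, Profile.mk.injEq]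
    grind
  · obtain ⟨p, hp, hpe, hp6⟩ :=
      Multiset.countP_pos.1 (show 0 < G.countP (fun p => Even p ∧ 6 ≤ p) by omega)
    refine take hp ?_
    rw [profile_takeOne (by omega) hp, Profile.mk.injEq]
    grind
  · exact ⟨_, .all (Multiset.card_pos.1 h), profile_map_pred hG⟩

theorem MoveB.zero_notMem {G H : Multiset ℕ} (hG : 0 ∉ G) (h : MoveB G H) : 0 ∉ H := by
  cases h with
  | @one p hp h1 =>
    have : 0 ∉ G.erase p := fun h => hG (Multiset.mem_of_mem_erase h)
    unfold takeOne
    split_ifs with hp1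
    · simpa using this
    · rw [Multiset.mem_add, Multiset.mem_singleton]
      exact not_or.2 ⟨this, by omega⟩
  | all => simp

theorem MoveB.card_le {G H : Multiset ℕ} (h : MoveB G H) : H.card ≤ G.card := by
  cases h with
  | @one p hp h1 =>
    have := Multiset.card_erase_add_one hp
    unfold takeOne
    split_ifs <;> simp <;> omega
  | all => exact (Multiset.card_le_card (Multiset.filter_le _ _)).trans (by simp)

theorem MoveB.sum_lt {G H : Multiset ℕ} (hG : 0 ∉ G) (h : MoveB G H) : H.sum < G.sum := by
  cases h with
  | @one p hp h1 =>
    have := Multiset.sum_erase hp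
    unfold takeOne
    split_ifs <;> simp <;> omega
  | all hne =>
    obtain ⟨p, hp⟩ := Multiset.exists_mem_of_ne_zero hne
    calc ((G.map (· - 1)).filter (· ≠ 0)).sum
        ≤ (G.map (· - 1)).sum := by
          conv_rhs => rw [← Multiset.filter_add_not (· ≠ 0) (G.map (· - 1)), Multiset.sum_add]
          exact Nat.le_add_right _ _
      _ < (G.map id).sum := Multiset.sum_lt_sum (fun q _ => Nat.sub_le q 1)
          ⟨p, hp, Nat.sub_one_lt fun h0 => hG (h0 ▸ hp)⟩
      _ = G.sum := by rw [Multiset.map_id]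

theorem outcome_of_card_le_five {G : Multiset ℕ} (hG : 0 ∉ G) (hcard : G.card ≤ 5) :
    ((profile G).IsP → PPosB G) ∧ (¬ (profile G).IsP → NPosB G) := by
  induction hs : G.sum using Nat.strong_induction_on generalizing G with
  | _ s ih =>
    subst hs
    have step {H} (h : MoveB G H) :=
      ih H.sum (h.sum_lt hG) (h.zero_notMem hG) (h.card_le.trans hcard) rfl
    have hodd := countP_odd_eq G
    have heven := card_eq_of_zero_notMem hG
    rw [Profile.isP_iff (f := G.count 4) hcard (by simp only [profile]; omega)
      (by simp only [profile]; omega)]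
    constructor
    · exact fun h => ⟨fun H m => (step m).2 (h _ (m.profile_mem_options hG))⟩
    · intro h
      push Not at h
      obtain ⟨t, ht, htP⟩ := h
      obtain ⟨H, m, rfl⟩ := exists_moveB_of_mem_options hG ht
      exact ⟨m, (step m).1 htP⟩

theorem pPosB_iff_profile_isP {G : Multiset ℕ} (hG : 0 ∉ G) (hcard : G.card ≤ 5) :
    PPosB G ↔ (profile G).IsP := by
  have h := outcome_of_card_le_five hG hcard
  exact ⟨fun hP => by_contra fun hn => hP.not_nPosB (h.2 hn), h.1⟩

theorem ne_of_count_eq_zero {G : Multiset ℕ} {k : ℕ} (h : G.count k = 0) : ∀ p ∈ G, p ≠ k := by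
  rintro p hp rfl
  exact Multiset.count_eq_zero.1 h hp

theorem three_le_of_odd {p : ℕ} (h : Odd p) (h1 : p ≠ 1) : 3 ≤ p := by grind

theorem five_le_of_odd {p : ℕ} (h : Odd p) (h1 : p ≠ 1) (h3 : p ≠ 3) : 5 ≤ p := by grind

theorem four_le_of_even {p : ℕ} (h : Even p) (h0 : p ≠ 0) (h2 : p ≠ 2) : 4 ≤ p := by grind

theorem exists_even_add_odd (G : Multiset ℕ) : ∃ E O : Multiset ℕ, G = E + O ∧
    (∀ x ∈ E, Even x) ∧ (∀ x ∈ O, Odd x) ∧ E.card + G.countP Odd = G.card ∧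
      O.card = G.countP Odd := by
  refine ⟨G.filter (¬ Odd ·), G.filter Odd, ?_, ?_, ?_, ?_, ?_⟩
  · rw [add_comm, Multiset.filter_add_not]
  · simp
  · simp
  · rw [Multiset.card_eq_countP_add_countP Odd G, Multiset.countP_eq_card_filter (¬ Odd ·), add_comm]
  · rw [Multiset.countP_eq_card_filter]

/-- In Version B, the classification of P-positions with exactly five piles. -/
theorem versionB_five_piles (G : Multiset ℕ) (hG : 0 ∉ G)
    (hcard : Multiset.card G = 5) :
    PPosB G ↔
      (∃ a b c, Even a ∧ Even b ∧ Even c ∧ G = {1, 1, a, b, c}) ∨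
      (∃ a b c, Even a ∧ Odd b ∧ Odd c ∧ G = {1, 1, a, b, c}) ∨
      (∃ a b c, Even a ∧ Even b ∧ Odd c ∧ 3 ≤ c ∧ G = {1, 2, a, b, c}) ∨
      (∃ a b c d, Even a ∧ Even b ∧ 4 ≤ a ∧ 4 ≤ b ∧ Odd c ∧ Odd d ∧ 5 ≤ c ∧ 5 ≤ d ∧
        G = {1, a, b, c, d}) ∨
      (∀ p ∈ G, Even p) ∨
      (∃ a b c d e, Even a ∧ Odd b ∧ Odd c ∧ Odd d ∧ Odd e ∧
        3 ≤ b ∧ 3 ≤ c ∧ 3 ≤ d ∧ 3 ≤ e ∧ G = {a, b, c, d, e}) ∨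
      ((∃ a b c d e, Even a ∧ Even b ∧ Even c ∧ Odd d ∧ Odd e ∧ 3 ≤ d ∧ 3 ≤ e ∧
          G = {a, b, c, d, e}) ∧
        ¬ (∃ a b c d, Even a ∧ Even b ∧ 4 ≤ a ∧ 4 ≤ b ∧ Odd c ∧ Odd d ∧ 5 ≤ c ∧ 5 ≤ d ∧
            G = {2, a, b, c, d})) := by
  rw [pPosB_iff_profile_isP hG hcard.le]
  simp only [Profile.IsP, profile, hcard, Nat.reduceLeDiff, Nat.reduceEqDiff, false_and, true_and,
    false_or]
  constructor
  · rintro (⟨h1, ho⟩ | ⟨h1, ⟨h2, ho⟩ | ⟨h2, ho, h3⟩⟩ | ⟨h1, ho | ho | ⟨ho, h2⟩⟩)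
    · obtain ⟨G, rfl⟩ :=
        Multiset.exists_cons_of_mem (Multiset.count_pos.1 (by omega : 0 < G.count 1))
      rw [Multiset.count_cons_self] at h1
      obtain ⟨G, rfl⟩ :=
        Multiset.exists_cons_of_mem (Multiset.count_pos.1 (by omega : 0 < G.count 1))
      simp only [Multiset.card_cons, Multiset.countP_cons, odd_one, if_true] at hcard ho
      obtain ⟨E, O, rfl, hE, hO, hEc, hOc⟩ := exists_even_add_odd G
      rcases ho with ho | ho
      · obtain ⟨a, b, c, rfl⟩ := Multiset.card_eq_three.1 (by omega : E.card = 3)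
        obtain rfl := Multiset.card_eq_zero.1 (by omega : O.card = 0)
        exact .inl ⟨a, b, c, hE a (by simp), hE b (by simp), hE c (by simp), rfl⟩
      · obtain ⟨a, rfl⟩ := Multiset.card_eq_one.1 (by omega : E.card = 1)
        obtain ⟨b, c, rfl⟩ := Multiset.card_eq_two.1 (by omega : O.card = 2)
        exact .inr <| .inl ⟨a, b, c, hE a (by simp), hO b (by simp), hO c (by simp), rfl⟩
    · obtain ⟨G, rfl⟩ :=
        Multiset.exists_cons_of_mem (Multiset.count_pos.1 (by omega : 0 < G.count 1))
      rw [Multiset.count_cons_of_ne (by decide)] at h2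
      obtain ⟨G, rfl⟩ :=
        Multiset.exists_cons_of_mem (Multiset.count_pos.1 (by omega : 0 < G.count 2))
      rw [Multiset.count_cons_self, Multiset.count_cons_of_ne (by decide)] at h1
      simp only [Multiset.card_cons, Multiset.countP_cons, odd_one, if_true, show ¬ Odd 2 by decide, if_false]
        at hcard ho
      have h1 := ne_of_count_eq_zero (by omega : G.count 1 = 0)
      obtain ⟨E, O, rfl, hE, hO, hEc, hOc⟩ := exists_even_add_odd G
      obtain ⟨a, b, rfl⟩ := Multiset.card_eq_two.1 (by omega : E.card = 2)
      obtain ⟨c, rfl⟩ := Multiset.card_eq_one.1 (by omega : O.card = 1)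
      exact .inr <| .inr <| .inl ⟨a, b, c, hE a (by simp), hE b (by simp), hO c (by simp),
        three_le_of_odd (hO c (by simp)) (h1 c (by simp)), rfl⟩
    · obtain ⟨G, rfl⟩ :=
        Multiset.exists_cons_of_mem (Multiset.count_pos.1 (by omega : 0 < G.count 1))
      rw [Multiset.count_cons_of_ne (by decide)] at h2 h3
      rw [Multiset.count_cons_self] at h1
      simp only [Multiset.card_cons, Multiset.countP_cons, odd_one, if_true] at hcard ho
      have h0 := ne_of_count_eq_zero (Multiset.count_eq_zero.2 fun h => hG (Multiset.mem_cons_of_mem (a := 0) h))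
      have h1 := ne_of_count_eq_zero (by omega : G.count 1 = 0)
      have h2 := ne_of_count_eq_zero h2
      have h3 := ne_of_count_eq_zero h3
      obtain ⟨E, O, rfl, hE, hO, hEc, hOc⟩ := exists_even_add_odd G
      obtain ⟨a, b, rfl⟩ := Multiset.card_eq_two.1 (by omega : E.card = 2)
      obtain ⟨c, d, rfl⟩ := Multiset.card_eq_two.1 (by omega : O.card = 2)
      have four_le (x) (hx : x ∈ ({a, b} : Multiset ℕ)) : 4 ≤ x :=
        have hx' := Multiset.mem_add.2 (.inl hx)
        four_le_of_even (hE x hx) (h0 x hx') (h2 x hx')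
      have five_le (x) (hx : x ∈ ({c, d} : Multiset ℕ)) : 5 ≤ x :=
        have hx' := Multiset.mem_add.2 (.inr hx)
        five_le_of_odd (hO x hx) (h1 x hx') (h3 x hx')
      exact .inr <| .inr <| .inr <| .inl ⟨a, b, c, d, hE a (by simp), hE b (by simp),
        four_le a (by simp), four_le b (by simp), hO c (by simp), hO d (by simp),
        five_le c (by simp), five_le d (by simp), rfl⟩
    · exact .inr <| .inr <| .inr <| .inr <| .inl fun p hp =>
        Nat.not_odd_iff_even.1 (Multiset.countP_eq_zero.1 ho p hp)
    · have h1 := ne_of_count_eq_zero h1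
      obtain ⟨E, O, rfl, hE, hO, hEc, hOc⟩ := exists_even_add_odd G
      obtain ⟨a, rfl⟩ := Multiset.card_eq_one.1 (by omega : E.card = 1)
      obtain ⟨b, c, d, e, rfl⟩ := Multiset.card_eq_four.1 (by omega : O.card = 4)
      have three_le (x) (hx : x ∈ ({b, c, d, e} : Multiset ℕ)) : 3 ≤ x :=
        three_le_of_odd (hO x hx) (h1 x (Multiset.mem_add.2 (.inr hx)))
      exact .inr <| .inr <| .inr <| .inr <| .inr <| .inl ⟨a, b, c, d, e, hE a (by simp),
        hO b (by simp), hO c (by simp), hO d (by simp), hO e (by simp), three_le b (by simp),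
        three_le c (by simp), three_le d (by simp), three_le e (by simp), rfl⟩
    · refine .inr <| .inr <| .inr <| .inr <| .inr <| .inr ⟨?_, ?_⟩
      · have h1 := ne_of_count_eq_zero h1
        obtain ⟨E, O, rfl, hE, hO, hEc, hOc⟩ := exists_even_add_odd G
        obtain ⟨a, b, c, rfl⟩ := Multiset.card_eq_three.1 (by omega : E.card = 3)
        obtain ⟨d, e, rfl⟩ := Multiset.card_eq_two.1 (by omega : O.card = 2)
        have three_le (x) (hx : x ∈ ({d, e} : Multiset ℕ)) : 3 ≤ x :=
          three_le_of_odd (hO x hx) (h1 x (Multiset.mem_add.2 (.inr hx)))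
        exact ⟨a, b, c, d, e, hE a (by simp), hE b (by simp), hE c (by simp), hO d (by simp),
          hO e (by simp), three_le d (by simp), three_le e (by simp), rfl⟩
      · rintro ⟨a, b, c, d, ha, hb, ha4, hb4, hc, hd, hc5, hd5, rfl⟩
        refine h2 ⟨?_, ?_⟩ <;>
          simp only [Multiset.insert_eq_cons, ← Multiset.cons_zero, Multiset.count_cons,
            Multiset.count_zero] <;>
          grind
  · rintro (⟨a, b, c, ha, hb, hc, rfl⟩ | ⟨a, b, c, ha, hb, hc, rfl⟩ |
      ⟨a, b, c, ha, hb, hc, hc3, rfl⟩ | ⟨a, b, c, d, ha, hb, ha4, hb4, hc, hd, hc5, hd5, rfl⟩ |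
      h | ⟨a, b, c, d, e, ha, hb, hc, hd, he, hb3, hc3, hd3, he3, rfl⟩ |
      ⟨⟨a, b, c, d, e, ha, hb, hc, hd, he, hd3, he3, rfl⟩, hne⟩)
    · simp only [Multiset.insert_eq_cons, ← Multiset.cons_zero, Multiset.count_cons,
        Multiset.countP_cons, Multiset.count_zero, Multiset.countP_zero]
      simp [*, Nat.not_odd_iff_even.2]
    · simp only [Multiset.insert_eq_cons, ← Multiset.cons_zero, Multiset.count_cons,
        Multiset.countP_cons, Multiset.count_zero, Multiset.countP_zero]
      simp [*, Nat.not_odd_iff_even.2]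
    · simp only [Multiset.insert_eq_cons, ← Multiset.cons_zero, Multiset.count_cons,
        Multiset.countP_cons, Multiset.count_zero, Multiset.countP_zero]
      simp [*, Nat.not_odd_iff_even.2]
      right; grind
    · simp only [Multiset.insert_eq_cons, ← Multiset.cons_zero, Multiset.count_cons,
        Multiset.countP_cons, Multiset.count_zero, Multiset.countP_zero]
      simp [*, Nat.not_odd_iff_even.2]
      omega
    · have h1 : 1 ∉ G := fun h1 => by simpa using h 1 h1
      have ho : G.countP Odd = 0 :=
        Multiset.countP_eq_zero.2 fun p hp => Nat.not_odd_iff_even.2 (h p hp)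
      simp [h1, ho]
    · simp only [Multiset.insert_eq_cons, ← Multiset.cons_zero, Multiset.count_cons,
        Multiset.countP_cons, Multiset.count_zero, Multiset.countP_zero]
      simp [*, Nat.not_odd_iff_even.2]
      right; grind
    · have hne_a : ¬ (a = 2 ∧ 4 ≤ b ∧ 4 ≤ c ∧ 5 ≤ d ∧ 5 ≤ e) := by
        rintro ⟨rfl, hb4, hc4, hd5, he5⟩
        exact hne ⟨b, c, d, e, hb, hc, hb4, hc4, hd, he, hd5, he5, rfl⟩
      have hne_b : ¬ (b = 2 ∧ 4 ≤ a ∧ 4 ≤ c ∧ 5 ≤ d ∧ 5 ≤ e) := by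
        rintro ⟨rfl, ha4, hc4, hd5, he5⟩
        exact hne ⟨a, c, d, e, ha, hc, ha4, hc4, hd, he, hd5, he5, Multiset.cons_swap ..⟩
      have hne_c : ¬ (c = 2 ∧ 4 ≤ a ∧ 4 ≤ b ∧ 5 ≤ d ∧ 5 ≤ e) := by
        rintro ⟨rfl, ha4, hb4, hd5, he5⟩
        refine hne ⟨a, b, d, e, ha, hb, ha4, hb4, hd, he, hd5, he5, ?_⟩
        simp only [Multiset.insert_eq_cons]
        rw [Multiset.cons_swap b 2, Multiset.cons_swap a 2]
      clear hne
      simp only [Multiset.insert_eq_cons, Multiset.mem_cons, Multiset.mem_singleton, not_or] at hG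
      simp only [Multiset.insert_eq_cons, ← Multiset.cons_zero, Multiset.count_cons,
        Multiset.countP_cons, Multiset.count_zero, Multiset.countP_zero]
      have even_ne {p : ℕ} (hp : Even p) : 1 ≠ p ∧ 3 ≠ p := by grind
      have odd_ne {p : ℕ} (hp : Odd p) (hp3 : 3 ≤ p) : 1 ≠ p ∧ 2 ≠ p := by grind
      simp only [ha, hb, hc, hd, he, even_ne, odd_ne, hd3, he3, if_true, if_false,
        Nat.not_odd_iff_even.2]
      have hd5 := five_le_of_odd hd (by omega)
      have he5 := five_le_of_odd he (by omega)
      have ha4 := four_le_of_even ha (Ne.symm hG.1)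
      have hb4 := four_le_of_even hb (Ne.symm hG.2.1)
      have hc4 := four_le_of_even hc (Ne.symm hG.2.2.1)
      right; right
      grind
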